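/- The generating function H(z, x, y) := E ( z^{|𝒯|} Σ_{v,w ∈ 𝒯} x^{d(v, v∧w)} y^{d(w, v∧w)} ), defined for |z|, |x|, |y| < 1, satisfies H(z, x, y) = [ z x y Φ''(F(z)) G(z, x) G(z, y) + z Φ'(F(z)) ( x G(z, x) + y G(z, y) ) + F(z) ] / ( 1 − z Φ'(F(z)) ). -/

import Mathlib

open scoped ENNReal BigOperators
open Set Filter

/-- Plane (ordered rooted) trees. -/
inductive PlaneTree : Type
  | node : List PlaneTree → PlaneTree

namespace PlaneTree

/-- The list of subtrees hanging off the root. -/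
def children : PlaneTree → List PlaneTree
  | .node ts => ts

/-- The subtree rooted at a given position (sequence of child indices), if it exists. -/
def subtreeAt : PlaneTree → List ℕ → Option PlaneTree
  | t, [] => some t
  | .node ts, i :: q =>
    match ts[i]? with
    | some t' => subtreeAt t' q
    | none => none

/-- The vertex set of a tree, with vertices identified with their positions. -/
def vertexSet (t : PlaneTree) : Set (List ℕ) := {q | (subtreeAt t q).isSome}

/-- The number of vertices of a tree. -/
noncomputable def size (t : PlaneTree) : ℕ := (vertexSet t).ncard

/-- The number of children of the vertex at position `q`. -/
def childCount (t : PlaneTree) (q : List ℕ) : ℕ :=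
  ((subtreeAt t q).map fun t' => t'.children.length).getD 0

end PlaneTree

/-- Longest common prefix of two positions; this is the position of the last common
ancestor of the two vertices. -/
def lca : List ℕ → List ℕ → List ℕ
  | a :: as, b :: bs => if a = b then a :: lca as bs else []
  | _, _ => []

/-- The distance from `v` up to the last common ancestor of `v` and `w`. -/
def dUp (v w : List ℕ) : ℕ := v.length - (lca v w).length

/-- The graph distance between the vertices at positions `v` and `w`. -/
def treeDist (v w : List ℕ) : ℕ := dUp v w + dUp w v

/-- The Galton–Watson probability of a given finite tree: the product, over all vertices,
of the probability that the offspring distribution takes the value given by the number of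
children of the vertex. -/
noncomputable def gwProb (p : ℕ → ℝ≥0∞) (t : PlaneTree) : ℝ≥0∞ :=
  ∏ᶠ v ∈ PlaneTree.vertexSet t, p (PlaneTree.childCount t v)

/-- `P(|𝒯| = n)` for the Galton–Watson tree `𝒯`. -/
noncomputable def probSize (p : ℕ → ℝ≥0∞) (n : ℕ) : ℝ≥0∞ :=
  ∑' t : PlaneTree, if PlaneTree.size t = n then gwProb p t else 0

/-- `E f(T_n)` where `T_n` is the Galton–Watson tree conditioned to have `n` vertices. -/
noncomputable def condExp (p : ℕ → ℝ≥0∞) (n : ℕ) (f : PlaneTree → ℝ≥0∞) : ℝ≥0∞ :=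
  (∑' t : PlaneTree, if PlaneTree.size t = n then gwProb p t * f t else 0) / probSize p n

/-- The variance of the offspring distribution `p` (which has mean `1`). -/
noncomputable def xiVar (p : ℕ → ℝ≥0∞) : ℝ≥0∞ :=
  ∑' k : ℕ, p k * ENNReal.ofReal (((k : ℝ) - 1) ^ 2)

/-- `P_k(t)`: the number of unordered pairs of vertices of `t` at graph distance `k`. -/
noncomputable def pairCount (t : PlaneTree) (k : ℕ) : ℕ :=
  {s : Set (List ℕ) | ∃ v w, v ∈ PlaneTree.vertexSet t ∧ w ∈ PlaneTree.vertexSet t ∧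
    s = {v, w} ∧ treeDist v w = k}.ncard

/-- `F(z) = E z^{|𝒯|}`, the probability generating function of the total progeny. -/
noncomputable def Fgen (p : ℕ → ℝ≥0∞) (z : ℂ) : ℂ :=
  ∑' t : PlaneTree, ((gwProb p t).toReal : ℂ) * z ^ PlaneTree.size t

/-- `Φ'(w)`, the derivative of the probability generating function `Φ(w) = E w^ξ` of the
offspring distribution. -/
noncomputable def PhiDeriv (p : ℕ → ℝ≥0∞) (w : ℂ) : ℂ :=
  ∑' k : ℕ, (k : ℂ) * ((p k).toReal : ℂ) * w ^ (k - 1)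

/-- `G(z, x) = E (z^{|𝒯|} ∑_{v ∈ 𝒯} x^{d(v, o)})`, where `o` is the root. -/
noncomputable def Ggen (p : ℕ → ℝ≥0∞) (z x : ℂ) : ℂ :=
  ∑' t : PlaneTree, ((gwProb p t).toReal : ℂ) * z ^ PlaneTree.size t *
    ∑ᶠ v ∈ PlaneTree.vertexSet t, x ^ v.length

/-- `Φ''(w)`, the second derivative of the probability generating function of the
offspring distribution. -/
noncomputable def PhiDeriv2 (p : ℕ → ℝ≥0∞) (w : ℂ) : ℂ :=
  ∑' k : ℕ, (k : ℂ) * ((k : ℂ) - 1) * ((p k).toReal : ℂ) * w ^ (k - 2)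

/-- `H(z, x, y) = E (z^{|𝒯|} ∑_{v,w ∈ 𝒯} x^{d(v, v∧w)} y^{d(w, v∧w)})`
(sum over ordered pairs of vertices). -/
noncomputable def Hgen (p : ℕ → ℝ≥0∞) (z x y : ℂ) : ℂ :=
  ∑' t : PlaneTree, ((gwProb p t).toReal : ℂ) * z ^ PlaneTree.size t *
    ∑ᶠ v ∈ PlaneTree.vertexSet t, ∑ᶠ w ∈ PlaneTree.vertexSet t,
      x ^ dUp v w * y ^ dUp w v

namespace PlaneTree

theorem induction_ofFn {P : PlaneTree → Prop}
    (h : ∀ (k : ℕ) (f : Fin k → PlaneTree), (∀ i, P (f i)) → P (.node (List.ofFn f))) :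
    ∀ t, P t
  | .node ts => by
    have hts := h ts.length ts.get fun i => induction_ofFn h (ts.get i)
    rwa [List.ofFn_get] at hts
  decreasing_by
    have := List.sizeOf_lt_of_mem (List.get_mem ts i)
    simp only [PlaneTree.node.sizeOf_spec]
    omega

/-- A plane tree amounts to a finite sequence of plane trees. -/
def nodeEquiv : (Σ k : ℕ, Fin k → PlaneTree) ≃ PlaneTree :=
  List.equivSigmaTuple.symm.trans ⟨.node, children, fun _ => rfl, fun ⟨_⟩ => rfl⟩

theorem subtreeAt_nil (t : PlaneTree) : t.subtreeAt [] = some t := by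
  unfold subtreeAt
  rfl

theorem subtreeAt_cons {k : ℕ} (f : Fin k → PlaneTree) (i : Fin k) (q : List ℕ) :
    (node (List.ofFn f)).subtreeAt (i.val :: q) = (f i).subtreeAt q := by
  rw [subtreeAt]
  simp

theorem vertexSet_node {k : ℕ} (f : Fin k → PlaneTree) :
    (node (List.ofFn f)).vertexSet =
      insert [] (⋃ i : Fin k, (fun q => i.val :: q) '' (f i).vertexSet) := by
  ext q
  rcases q with _ | ⟨j, q⟩
  · simp [vertexSet, subtreeAt_nil]
  · simp only [vertexSet, mem_ofPred_eq, mem_insert_iff, reduceCtorEq, false_or, mem_iUnion,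
      mem_image, List.cons.injEq]
    by_cases hj : j < k
    · have := subtreeAt_cons f ⟨j, hj⟩ q
      simp only at this
      rw [this]
      constructor
      · exact fun h => ⟨⟨j, hj⟩, q, h, rfl, rfl⟩
      · rintro ⟨⟨i, hi⟩, q', h, rfl, rfl⟩
        exact h
    · have : (node (List.ofFn f)).subtreeAt (j :: q) = none := by
        rw [subtreeAt]
        simp [hj]
      rw [this]
      simp only [Option.isSome_none, Bool.false_eq_true, false_iff]
      rintro ⟨⟨i, hi⟩, q', h, rfl, rfl⟩
      exact hj hi

theorem finite_vertexSet (t : PlaneTree) : t.vertexSet.Finite := by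
  induction t using induction_ofFn with
  | h k f ih =>
    rw [vertexSet_node]
    exact (finite_iUnion fun i => (ih i).image _).insert _

@[to_additive]
theorem finprod_mem_vertexSet_node {M : Type*} [CommMonoid M] {k : ℕ} (f : Fin k → PlaneTree)
    (g : List ℕ → M) :
    ∏ᶠ v ∈ (node (List.ofFn f)).vertexSet, g v =
      g [] * ∏ i : Fin k, ∏ᶠ v ∈ (f i).vertexSet, g (i.val :: v) := by
  have hfin : ∀ i : Fin k, ((fun q => i.val :: q) '' (f i).vertexSet).Finite :=
    fun i => (finite_vertexSet _).image _
  rw [vertexSet_node, finprod_mem_insert _ (by simp) (finite_iUnion hfin),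
    finprod_mem_iUnion _ hfin, finprod_eq_prod_of_fintype]
  · congr 1
    refine Finset.prod_congr rfl fun i _ => ?_
    exact finprod_mem_image (List.cons_injective.injOn)
  · intro i j hij
    refine Set.disjoint_left.2 ?_
    rintro _ ⟨v, -, rfl⟩ ⟨w, -, hw⟩
    exact hij (Fin.ext (List.cons.inj hw).1.symm)

theorem size_eq_finsum (t : PlaneTree) : t.size = ∑ᶠ v ∈ t.vertexSet, 1 := by
  rw [finsum_mem_eq_finite_toFinset_sum _ t.finite_vertexSet, size,
    Set.ncard_eq_toFinset_card _ t.finite_vertexSet]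
  simp

theorem size_node {k : ℕ} (f : Fin k → PlaneTree) :
    (node (List.ofFn f)).size = 1 + ∑ i, (f i).size := by
  simp only [size_eq_finsum, finsum_mem_vertexSet_node]

theorem childCount_nil {k : ℕ} (f : Fin k → PlaneTree) :
    (node (List.ofFn f)).childCount [] = k := by
  simp [childCount, subtreeAt_nil, children]

theorem childCount_cons {k : ℕ} (f : Fin k → PlaneTree) (i : Fin k) (q : List ℕ) :
    (node (List.ofFn f)).childCount (i.val :: q) = (f i).childCount q := by
  simp [childCount, subtreeAt_cons]

theorem gwProb_node (p : ℕ → ℝ≥0∞) {k : ℕ} (f : Fin k → PlaneTree) :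
    gwProb p (node (List.ofFn f)) = p k * ∏ i, gwProb p (f i) := by
  simp only [gwProb, finprod_mem_vertexSet_node, childCount_nil, childCount_cons]

/-- The weight `P(𝒯 = t) z ^ |t|` of a tree `t`. -/
noncomputable def weight (p : ℕ → ℝ≥0∞) (z : ℂ) (t : PlaneTree) : ℂ :=
  ((gwProb p t).toReal : ℂ) * z ^ t.size

/-- The sum of `x ^ d(v, o)` over the vertices `v` of a tree with root `o`. -/
noncomputable def depthSum (x : ℂ) (t : PlaneTree) : ℂ :=
  ∑ᶠ v ∈ t.vertexSet, x ^ v.length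

/-- The sum of `x ^ d(v, v ∧ w) * y ^ d(w, v ∧ w)` over the ordered pairs of vertices. -/
noncomputable def pairSum (x y : ℂ) (t : PlaneTree) : ℂ :=
  ∑ᶠ v ∈ t.vertexSet, ∑ᶠ w ∈ t.vertexSet, x ^ dUp v w * y ^ dUp w v

theorem weight_node (p : ℕ → ℝ≥0∞) (z : ℂ) {k : ℕ} (f : Fin k → PlaneTree) :
    weight p z (node (List.ofFn f)) = z * ((p k).toReal : ℂ) * ∏ i, weight p z (f i) := by
  simp only [weight, gwProb_node, size_node, ENNReal.toReal_mul, ENNReal.toReal_prod,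
    Finset.prod_mul_distrib, Finset.prod_pow_eq_pow_sum, pow_add, pow_one]
  push_cast
  ring

theorem mul_depthSum (x : ℂ) (t : PlaneTree) :
    x * depthSum x t = ∑ᶠ v ∈ t.vertexSet, x ^ (v.length + 1) := by
  rw [depthSum, finsum_mem_eq_finite_toFinset_sum _ t.finite_vertexSet,
    finsum_mem_eq_finite_toFinset_sum _ t.finite_vertexSet, Finset.mul_sum]
  simp only [pow_succ']

theorem dUp_nil_left (w : List ℕ) : dUp [] w = 0 := by
  simp [dUp]

theorem dUp_nil_right (v : List ℕ) : dUp v [] = v.length := by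
  cases v <;> simp [dUp, lca]

theorem dUp_cons_self (a : ℕ) (v w : List ℕ) : dUp (a :: v) (a :: w) = dUp v w := by
  simp [dUp, lca]

theorem dUp_cons_of_ne {a b : ℕ} (h : a ≠ b) (v w : List ℕ) :
    dUp (a :: v) (b :: w) = v.length + 1 := by
  simp [dUp, lca, h]

theorem pairSum_node (x y : ℂ) {k : ℕ} (f : Fin k → PlaneTree) :
    pairSum x y (node (List.ofFn f)) =
      1 + x * ∑ i, depthSum x (f i) + y * ∑ i, depthSum y (f i) + ∑ i, pairSum x y (f i) +
        x * y * ∑ q ∈ (Finset.univ : Finset (Fin k)).offDiag,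
          depthSum x (f q.1) * depthSum y (f q.2) := by
  have hcross : ∀ i j : Fin k,
      ∑ᶠ v ∈ (f i).vertexSet, ∑ᶠ w ∈ (f j).vertexSet,
        x ^ dUp (i.val :: v) (j.val :: w) * y ^ dUp (j.val :: w) (i.val :: v) =
      if i = j then pairSum x y (f i)
      else x * y * (depthSum x (f i) * depthSum y (f j)) := by
    intro i j
    split_ifs with hij
    · subst hij
      simp only [dUp_cons_self, pairSum]
    · have hij' : i.val ≠ j.val := fun h => hij (Fin.ext h)
      simp only [dUp_cons_of_ne hij', dUp_cons_of_ne hij'.symm]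
      rw [mul_mul_mul_comm, mul_depthSum, mul_depthSum]
      simp only [finsum_mem_eq_finite_toFinset_sum _ (finite_vertexSet _), Finset.sum_mul_sum]
  have hsplit : ∀ i : Fin k,
      ∑ᶠ v ∈ (f i).vertexSet, (x ^ (v.length + 1) + ∑ j : Fin k, ∑ᶠ w ∈ (f j).vertexSet,
        x ^ dUp (i.val :: v) (j.val :: w) * y ^ dUp (j.val :: w) (i.val :: v)) =
      x * depthSum x (f i) + ∑ j : Fin k, if i = j then pairSum x y (f i)
        else x * y * (depthSum x (f i) * depthSum y (f j)) := by
    intro i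
    rw [finsum_mem_add_distrib (finite_vertexSet _), ← mul_depthSum]
    simp only [← hcross]
    simp only [finsum_mem_eq_finite_toFinset_sum _ (finite_vertexSet _)]
    rw [Finset.sum_comm]
  rw [pairSum]
  simp only [finsum_mem_vertexSet_node, dUp_nil_left, dUp_nil_right, pow_zero, mul_one, one_mul,
    List.length_nil, List.length_cons, hsplit, ← mul_depthSum]
  have hdiag : ∑ i : Fin k, ∑ j : Fin k, (if i = j then pairSum x y (f i)
        else x * y * (depthSum x (f i) * depthSum y (f j))) =
      ∑ i, pairSum x y (f i) + x * y * ∑ q ∈ (Finset.univ : Finset (Fin k)).offDiag,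
          depthSum x (f q.1) * depthSum y (f q.2) := by
    rw [← Finset.sum_product', ← Finset.diag_union_offDiag,
      Finset.sum_union (Finset.disjoint_diag_offDiag _), Finset.mul_sum]
    congr 1
    · simp
    · refine Finset.sum_congr rfl fun q hq => ?_
      rw [if_neg (Finset.mem_offDiag.1 hq).2.2]
  rw [Finset.sum_add_distrib, hdiag]
  simp only [Finset.mul_sum]
  ring

theorem tsum_eq_tsum_ofFn (u : PlaneTree → ℝ≥0∞) :
    ∑' t, u t = ∑' (k : ℕ) (f : Fin k → PlaneTree), u (.node (List.ofFn f)) := by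
  rw [← nodeEquiv.tsum_eq, ENNReal.tsum_sigma']
  rfl

theorem hasSum_ofFn {u : PlaneTree → ℂ} (hu : Summable u) {c : ℕ → ℂ}
    (hc : ∀ k, HasSum (fun f : Fin k → PlaneTree => u (.node (List.ofFn f))) (c k)) :
    HasSum c (∑' t, u t) :=
  HasSum.sigma (f := u ∘ nodeEquiv) (nodeEquiv.hasSum_iff.2 hu.hasSum) hc

theorem _root_.ENNReal.tsum_prod_fin {α : Type*} (a : α → ℝ≥0∞) (k : ℕ) :
    ∑' f : Fin k → α, ∏ i, a (f i) = (∑' t, a t) ^ k := by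
  induction k with
  | zero => simp
  | succ k ih =>
    rw [← (Fin.consEquiv fun _ => α).tsum_eq, ENNReal.tsum_prod']
    simp only [Fin.consEquiv, Equiv.coe_fn_mk, Fin.prod_univ_succ, Fin.cons_zero, Fin.cons_succ,
      ENNReal.tsum_mul_left, ih, ENNReal.tsum_mul_right]
    rw [pow_succ']

theorem _root_.HasSum.mul_complex {α β : Type*} {u : α → ℂ} {v : β → ℂ} {a b : ℂ}
    (hu : HasSum u a) (hv : HasSum v b) : HasSum (fun q : α × β => u q.1 * v q.2) (a * b) :=
  hu.mul hv (summable_mul_of_summable_norm hu.summable.norm hv.summable.norm)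

theorem _root_.hasSum_prod_fin {α : Type*} {k : ℕ} {a : Fin k → α → ℂ}
    (ha : ∀ i, Summable (a i)) :
    HasSum (fun f : Fin k → α => ∏ i, a i (f i)) (∏ i, ∑' t, a i t) := by
  induction k with
  | zero => simp
  | succ k ih =>
    have hrec := ih fun i => ha i.succ
    rw [Fin.prod_univ_succ, ← (Fin.consEquiv fun _ => α).hasSum_iff]
    refine ((ha 0).hasSum.mul_complex hrec).congr_fun fun q => ?_
    simp [Fin.consEquiv, Fin.prod_univ_succ]

theorem size_pos (t : PlaneTree) : 0 < t.size := by
  induction t using induction_ofFn with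
  | h k f _ =>
    rw [size_node]
    omega

theorem tsum_gwProb_size_le (p : ℕ → ℝ≥0∞) (hp : ∑' k : ℕ, p k = 1) (n : ℕ) :
    ∑' t, (if t.size ≤ n then gwProb p t else 0) ≤ 1 := by
  induction n with
  | zero => simp [(size_pos _).ne']
  | succ n ih =>
    rw [tsum_eq_tsum_ofFn]
    calc
      _ ≤ ∑' (k : ℕ) (f : Fin k → PlaneTree),
          p k * ∏ i, (if (f i).size ≤ n then gwProb p (f i) else 0) := by
        refine ENNReal.tsum_le_tsum fun k => ENNReal.tsum_le_tsum fun f => ?_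
        split_ifs with h
        · rw [gwProb_node]
          rw [size_node] at h
          have hle : ∀ i, (f i).size ≤ n := fun i => by
            have := Finset.single_le_sum (f := fun i => (f i).size) (fun _ _ => Nat.zero_le _)
              (Finset.mem_univ i)
            omega
          simp [hle]
        · exact zero_le
      _ = ∑' k, p k * (∑' t, (if t.size ≤ n then gwProb p t else 0)) ^ k := by
        simp only [ENNReal.tsum_mul_left,
          ENNReal.tsum_prod_fin fun t : PlaneTree => if t.size ≤ n then gwProb p t else 0]
      _ ≤ ∑' k, p k := by
        refine ENNReal.tsum_le_tsum fun k => ?_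
        exact mul_le_of_le_one_right zero_le (pow_le_one' ih k)
      _ = 1 := hp

theorem tsum_gwProb_le_one (p : ℕ → ℝ≥0∞) (hp : ∑' k : ℕ, p k = 1) :
    ∑' t, gwProb p t ≤ 1 := by
  rw [ENNReal.tsum_eq_iSup_sum]
  refine iSup_le fun s => ?_
  refine le_trans ?_ (tsum_gwProb_size_le p hp (s.sup size))
  refine le_trans (le_of_eq ?_) (ENNReal.sum_le_tsum s)
  exact Finset.sum_congr rfl fun t ht => (if_pos (Finset.le_sup ht)).symm

theorem summable_gwProb {p : ℕ → ℝ≥0∞} (hp : ∑' k : ℕ, p k = 1) :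
    Summable fun t => (gwProb p t).toReal :=
  ENNReal.summable_toReal ((tsum_gwProb_le_one p hp).trans_lt ENNReal.one_lt_top).ne

theorem summable_weight_mul {p : ℕ → ℝ≥0∞} (hp : ∑' k : ℕ, p k = 1) {z : ℂ} (hz : ‖z‖ < 1)
    {u : PlaneTree → ℂ} {m : ℕ} (hu : ∀ t, ‖u t‖ ≤ (t.size : ℝ) ^ m) :
    Summable fun t => weight p z t * u t := by
  obtain ⟨C, hC⟩ : ∃ C : ℝ, ∀ n : ℕ, (n : ℝ) ^ m * ‖z‖ ^ n ≤ C := by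
    have hs := (summable_pow_mul_geometric_of_norm_lt_one m
      (r := ‖z‖) (by simpa using hz)).tendsto_atTop_zero
    obtain ⟨C, hC⟩ := hs.bddAbove_range
    exact ⟨C, fun n => hC ⟨n, rfl⟩⟩
  refine .of_norm_bounded ((summable_gwProb hp).mul_right C) fun t => ?_
  rw [weight, norm_mul, norm_mul, norm_pow, mul_assoc]
  simp only [Complex.norm_real, Real.norm_eq_abs, abs_of_nonneg ENNReal.toReal_nonneg]
  refine mul_le_mul_of_nonneg_left ?_ ENNReal.toReal_nonneg
  calc ‖z‖ ^ t.size * ‖u t‖ ≤ ‖z‖ ^ t.size * (t.size : ℝ) ^ m := by gcongr; exact hu t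
    _ = (t.size : ℝ) ^ m * ‖z‖ ^ t.size := mul_comm _ _
    _ ≤ C := hC _

theorem norm_finsum_mem_vertexSet_le (t : PlaneTree) {g : List ℕ → ℂ} {B : ℝ}
    (hg : ∀ v, ‖g v‖ ≤ B) : ‖∑ᶠ v ∈ t.vertexSet, g v‖ ≤ t.size * B := by
  rw [finsum_mem_eq_finite_toFinset_sum _ t.finite_vertexSet, size,
    Set.ncard_eq_toFinset_card _ t.finite_vertexSet, ← nsmul_eq_mul]
  exact norm_sum_le_of_le _ (fun v _ => hg v) |>.trans_eq (by simp)

theorem norm_depthSum_le {x : ℂ} (hx : ‖x‖ < 1) (t : PlaneTree) :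
    ‖depthSum x t‖ ≤ (t.size : ℝ) ^ 1 := by
  rw [pow_one, ← mul_one (t.size : ℝ)]
  refine t.norm_finsum_mem_vertexSet_le fun v => ?_
  rw [norm_pow]
  exact pow_le_one₀ (norm_nonneg _) hx.le

theorem norm_pairSum_le {x y : ℂ} (hx : ‖x‖ < 1) (hy : ‖y‖ < 1) (t : PlaneTree) :
    ‖pairSum x y t‖ ≤ (t.size : ℝ) ^ 2 := by
  rw [pow_two]
  refine t.norm_finsum_mem_vertexSet_le fun v => ?_
  rw [← mul_one (t.size : ℝ)]
  refine t.norm_finsum_mem_vertexSet_le fun w => ?_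
  rw [norm_mul, norm_pow, norm_pow]
  exact mul_le_one₀ (pow_le_one₀ (norm_nonneg _) hx.le) (by positivity)
    (pow_le_one₀ (norm_nonneg _) hy.le)

theorem norm_Fgen_le_one {p : ℕ → ℝ≥0∞} (hp : ∑' k : ℕ, p k = 1) {z : ℂ} (hz : ‖z‖ < 1) :
    ‖Fgen p z‖ ≤ 1 := by
  refine (tsum_of_norm_bounded (summable_gwProb hp).hasSum fun t => ?_).trans ?_
  · rw [norm_mul, norm_pow, Complex.norm_real, Real.norm_of_nonneg ENNReal.toReal_nonneg]
    exact mul_le_of_le_one_right ENNReal.toReal_nonneg (pow_le_one₀ (norm_nonneg _) hz.le)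
  · have hle := tsum_gwProb_le_one p hp
    have hne := (hle.trans_lt ENNReal.one_lt_top).ne
    rw [← ENNReal.tsum_toReal_eq fun t => ENNReal.ne_top_of_tsum_ne_top hne t]
    exact ENNReal.toReal_le_of_le_ofReal zero_le_one (by simpa using hle)

/-- Summing over `f` with one marked coordinate `i`. -/
theorem _root_.hasSum_prod_fin_mul {α : Type*} {k : ℕ} {a b : α → ℂ} (ha : Summable a)
    (hb : Summable fun t => a t * b t) (i : Fin k) :
    HasSum (fun f : Fin k → α => (∏ j, a (f j)) * b (f i))
      ((∑' t, a t * b t) * (∑' t, a t) ^ (k - 1)) := by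
  have h := hasSum_prod_fin (a := fun j : Fin k => fun t => a t * if j = i then b t else 1)
    fun j => by by_cases h : j = i <;> simp [h, ha, hb]
  have hval : ∏ j : Fin k, ∑' t, a t * (if j = i then b t else 1) =
      (∑' t, a t * b t) * (∑' t, a t) ^ (k - 1) := by
    rw [← Finset.mul_prod_erase _ _ (Finset.mem_univ i)]
    congr 1
    · simp
    · rw [Finset.prod_congr rfl (g := fun _ => ∑' t, a t) fun j hj => by
        simp [Finset.ne_of_mem_erase hj]]
      simp
  rw [← hval]
  refine h.congr_fun fun f => ?_
  simp only [Finset.prod_mul_distrib, Finset.prod_ite_eq', Finset.mem_univ, if_true]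

/-- Summing over `f` with two distinct marked coordinates `i` and `j`. -/
theorem _root_.hasSum_prod_fin_mul_mul {α : Type*} {k : ℕ} {a b c : α → ℂ} (ha : Summable a)
    (hb : Summable fun t => a t * b t) (hc : Summable fun t => a t * c t) {i j : Fin k}
    (hij : i ≠ j) :
    HasSum (fun f : Fin k → α => (∏ l, a (f l)) * (b (f i) * c (f j)))
      ((∑' t, a t * b t) * (∑' t, a t * c t) * (∑' t, a t) ^ (k - 2)) := by
  have h := hasSum_prod_fin
    (a := fun l : Fin k => fun t => a t * ((if l = i then b t else 1) * if l = j then c t else 1))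
    fun l => by
      by_cases h : l = i
      · simp [h, hij, hb]
      · by_cases h' : l = j <;> simp [h', hij.symm, h, ha, hc]
  have hval : ∏ l : Fin k, ∑' t, a t * ((if l = i then b t else 1) * if l = j then c t else 1) =
      (∑' t, a t * b t) * (∑' t, a t * c t) * (∑' t, a t) ^ (k - 2) := by
    rw [← Finset.mul_prod_erase _ _ (Finset.mem_univ i),
      ← Finset.mul_prod_erase _ _ (Finset.mem_erase.2 ⟨hij.symm, Finset.mem_univ j⟩), mul_assoc]
    congr 1
    · simp [hij]
    congr 1
    · simp [hij.symm]
    · rw [Finset.prod_congr rfl (g := fun _ => ∑' t, a t) fun l hl => by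
        simp [Finset.ne_of_mem_erase hl, Finset.ne_of_mem_erase (Finset.mem_of_mem_erase hl)]]
      rw [Finset.prod_const, Finset.card_erase_of_mem (by simp [hij.symm]),
        Finset.card_erase_of_mem (Finset.mem_univ _), Finset.card_univ, Fintype.card_fin,
        Nat.sub_sub]
  rw [← hval]
  refine h.congr_fun fun f => ?_
  simp only [Finset.prod_mul_distrib, Finset.prod_ite_eq', Finset.mem_univ, if_true]

end PlaneTree

theorem norm_PhiDeriv_term_le (p : ℕ → ℝ≥0∞) {w : ℂ} (hw : ‖w‖ ≤ 1) (k : ℕ) :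
    ‖(k : ℂ) * ((p k).toReal : ℂ) * w ^ (k - 1)‖ ≤ ((k : ℝ≥0∞) * p k).toReal := by
  rw [norm_mul, norm_mul, norm_pow, Complex.norm_real, Real.norm_of_nonneg ENNReal.toReal_nonneg,
    Complex.norm_natCast, ENNReal.toReal_mul, ENNReal.toReal_natCast]
  exact mul_le_of_le_one_right (by positivity) (pow_le_one₀ (norm_nonneg _) hw)

theorem summable_PhiDeriv {p : ℕ → ℝ≥0∞} (hmean : ∑' k : ℕ, (k : ℝ≥0∞) * p k = 1) {w : ℂ}
    (hw : ‖w‖ ≤ 1) : Summable fun k : ℕ => (k : ℂ) * ((p k).toReal : ℂ) * w ^ (k - 1) :=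
  .of_norm_bounded (ENNReal.summable_toReal (by simp [hmean])) (norm_PhiDeriv_term_le p hw)

theorem norm_PhiDeriv_le_one {p : ℕ → ℝ≥0∞} (hmean : ∑' k : ℕ, (k : ℝ≥0∞) * p k = 1) {w : ℂ}
    (hw : ‖w‖ ≤ 1) : ‖PhiDeriv p w‖ ≤ 1 := by
  have hne : ∑' k : ℕ, (k : ℝ≥0∞) * p k ≠ ⊤ := by simp [hmean]
  refine (tsum_of_norm_bounded (ENNReal.summable_toReal hne).hasSum
    (norm_PhiDeriv_term_le p hw)).trans_eq ?_
  rw [← ENNReal.tsum_toReal_eq fun k => ENNReal.ne_top_of_tsum_ne_top hne k, hmean,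
    ENNReal.toReal_one]

theorem summable_PhiDeriv2 {p : ℕ → ℝ≥0∞} (hvar_fin : xiVar p ≠ ⊤) {w : ℂ} (hw : ‖w‖ ≤ 1) :
    Summable fun k : ℕ => (k : ℂ) * ((k : ℂ) - 1) * ((p k).toReal : ℂ) * w ^ (k - 2) := by
  refine .of_norm_bounded ((ENNReal.summable_toReal hvar_fin).mul_left 2) fun k => ?_
  have hnorm : ‖(k : ℂ) * ((k : ℂ) - 1)‖ ≤ 2 * ((k : ℝ) - 1) ^ 2 := by
    rw [show (k : ℂ) * ((k : ℂ) - 1) = ((k * (k - 1) : ℝ) : ℂ) by push_cast; ring,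
      Complex.norm_real]
    rcases k with _ | _ | k
    · simp
    · simp
    · push_cast
      rw [Real.norm_of_nonneg (by nlinarith [(k.cast_nonneg : (0 : ℝ) ≤ k)])]
      nlinarith [(k.cast_nonneg : (0 : ℝ) ≤ k)]
  rw [norm_mul, norm_mul, norm_pow, Complex.norm_real, Real.norm_of_nonneg ENNReal.toReal_nonneg,
    ENNReal.toReal_mul, ENNReal.toReal_ofReal (sq_nonneg _)]
  calc _ ≤ ‖(k : ℂ) * ((k : ℂ) - 1)‖ * (p k).toReal :=
        mul_le_of_le_one_right (by positivity) (pow_le_one₀ (norm_nonneg _) hw)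
    _ ≤ 2 * ((k : ℝ) - 1) ^ 2 * (p k).toReal := by gcongr
    _ = _ := by ring

open PlaneTree in
/-- The functional equation of `F`, in series form. -/
theorem hasSum_Fgen {p : ℕ → ℝ≥0∞} (hp : ∑' k : ℕ, p k = 1) {z : ℂ} (hz : ‖z‖ < 1) :
    HasSum (fun k => z * (((p k).toReal : ℂ) * Fgen p z ^ k)) (Fgen p z) := by
  have hF : Summable (weight p z) := by
    simpa using summable_weight_mul hp hz (u := fun _ => 1) (m := 0) (by simp)
  refine hasSum_ofFn hF fun k => ?_
  have h := (hasSum_prod_fin fun _ : Fin k => hF).mul_left (z * ((p k).toReal : ℂ))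
  simp only [← weight_node, Finset.prod_const, Finset.card_univ, Fintype.card_fin] at h
  rwa [mul_assoc] at h

open PlaneTree in
/-- The contribution to `H` of the trees whose root has `k` children. -/
theorem hasSum_Hgen {p : ℕ → ℝ≥0∞} (hp : ∑' k : ℕ, p k = 1) {z x y : ℂ} (hz : ‖z‖ < 1)
    (hx : ‖x‖ < 1) (hy : ‖y‖ < 1) :
    HasSum (fun k : ℕ =>
      z * (((p k).toReal : ℂ) * Fgen p z ^ k) +
      z * (x * Ggen p z x + y * Ggen p z y + Hgen p z x y) *
        ((k : ℂ) * ((p k).toReal : ℂ) * Fgen p z ^ (k - 1)) +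
      z * x * y * Ggen p z x * Ggen p z y *
        ((k : ℂ) * ((k : ℂ) - 1) * ((p k).toReal : ℂ) * Fgen p z ^ (k - 2))) (Hgen p z x y) := by
  have hF : Summable (weight p z) := by
    simpa using summable_weight_mul hp hz (u := fun _ => 1) (m := 0) (by simp)
  have hGx := summable_weight_mul hp hz (norm_depthSum_le hx)
  have hGy := summable_weight_mul hp hz (norm_depthSum_le hy)
  have hH := summable_weight_mul hp hz (norm_pairSum_le hx hy)
  refine hasSum_ofFn hH fun k => ?_
  have hone := hasSum_prod_fin fun _ : Fin k => hF
  have hsum {b : PlaneTree → ℂ} (hb : Summable fun t => weight p z t * b t) :=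
    hasSum_sum (s := (Finset.univ : Finset (Fin k))) fun i _ => hasSum_prod_fin_mul hF hb i
  have hoff := hasSum_sum (s := (Finset.univ : Finset (Fin k)).offDiag) fun q hq =>
    hasSum_prod_fin_mul_mul hF hGx hGy (Finset.mem_offDiag.1 hq).2.2
  have htotal := ((((hone.add ((hsum hGx).mul_left x)).add ((hsum hGy).mul_left y)).add
    (hsum hH)).add (hoff.mul_left (x * y))).mul_left (z * ((p k).toReal : ℂ))
  convert! htotal using 1
  · funext f
    rw [weight_node, pairSum_node]
    simp only [← Finset.mul_sum]
    ring
  · have hcard : (((Finset.univ : Finset (Fin k)).offDiag.card : ℕ) : ℂ) =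
        (k : ℂ) * ((k : ℂ) - 1) := by
      rw [Finset.offDiag_card, Finset.card_univ, Fintype.card_fin,
        Nat.cast_sub (Nat.le_mul_self k)]
      push_cast
      ring
    simp only [Finset.sum_const, nsmul_eq_mul, hcard, Finset.prod_const, Finset.card_univ,
      Fintype.card_fin]
    change _ = z * ((p k).toReal : ℂ) * (Fgen p z ^ k +
      x * (k * (Ggen p z x * Fgen p z ^ (k - 1))) + y * (k * (Ggen p z y * Fgen p z ^ (k - 1))) +
      k * (Hgen p z x y * Fgen p z ^ (k - 1)) +
      x * y * (k * (k - 1) * (Ggen p z x * Ggen p z y * Fgen p z ^ (k - 2))))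
    ring

/-- formula (4.2) of Devroye–Janson.  For `|z|, |x|, |y| < 1`,
`H(z,x,y) = [zxyΦ''(F(z))G(z,x)G(z,y) + zΦ'(F(z))(xG(z,x) + yG(z,y)) + F(z)] / (1 - zΦ'(F(z)))`. -/
theorem Hgen_eq
    (p : ℕ → ℝ≥0∞) (hp : ∑' k : ℕ, p k = 1)
    (hmean : ∑' k : ℕ, (k : ℝ≥0∞) * p k = 1)
    (hvar_pos : 0 < xiVar p) (hvar_fin : xiVar p ≠ ⊤) :
    ∀ z x y : ℂ, ‖z‖ < 1 → ‖x‖ < 1 → ‖y‖ < 1 →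
      Hgen p z x y =
        (z * x * y * PhiDeriv2 p (Fgen p z) * Ggen p z x * Ggen p z y
          + z * PhiDeriv p (Fgen p z) * (x * Ggen p z x + y * Ggen p z y)
          + Fgen p z) / (1 - z * PhiDeriv p (Fgen p z)) := by
  intro z x y hz hx hy
  have hF := PlaneTree.norm_Fgen_le_one hp hz
  have hden : 1 - z * PhiDeriv p (Fgen p z) ≠ 0 := by
    intro h
    have hlt : ‖z * PhiDeriv p (Fgen p z)‖ < 1 := by
      rw [norm_mul]
      exact (mul_le_of_le_one_right (norm_nonneg _) (norm_PhiDeriv_le_one hmean hF)).trans_lt hz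
    rw [← sub_eq_zero.1 h, norm_one] at hlt
    exact lt_irrefl _ hlt
  have hrhs := ((hasSum_Fgen hp hz).add
    ((summable_PhiDeriv hmean hF).hasSum.mul_left
      (z * (x * Ggen p z x + y * Ggen p z y + Hgen p z x y)))).add
    ((summable_PhiDeriv2 hvar_fin hF).hasSum.mul_left (z * x * y * Ggen p z x * Ggen p z y))
  have heq := (hasSum_Hgen hp hz hx hy).unique hrhs
  rw [← PhiDeriv, ← PhiDeriv2] at heq
  rw [eq_div_iff hden]
  linear_combination heq
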